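/- Fix a real number p ≥ 2 and an integer n ≥ 1, and let φ_n be as defined in the context. Then there exists a constant C, depending only on p and n, such that for every r ∈ ℝ: φ_n(r) ≤ C·r², |φ_n'(r)| ≤ C·|r|, and φ_n''(r) ≤ C. -/

import Mathlib

/-- The truncated power function `φ_n`: `φ_n(r) = |r|^p` for `|r| < n`, and the second-order
Taylor extension `n^{p-2} (p(p-1)/2)(|r|-n)² + p n^{p-1}(|r|-n) + n^p` for `|r| ≥ n`. -/
noncomputable def phi (p : ℝ) (n : ℕ) (r : ℝ) : ℝ :=
  if |r| < n then |r| ^ p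
  else (n : ℝ) ^ (p - 2) * (p * (p - 1) / 2) * (|r| - n) ^ 2
      + p * (n : ℝ) ^ (p - 1) * (|r| - n) + (n : ℝ) ^ p

/-- The derivative of `phi p n` on the positive half-line, extended by `0` to the negative one. -/
noncomputable def phiDerivPos (p : ℝ) (n : ℕ) (x : ℝ) : ℝ :=
  p * (max 0 (min x n)) ^ (p - 1)
    + p * (p - 1) * (n : ℝ) ^ (p - 2) * (max 0 x - max 0 (min x n))

lemma phi_neg (p : ℝ) (n : ℕ) (r : ℝ) : phi p n (-r) = phi p n r := by
  simp [phi]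

lemma phi_zero {p : ℝ} (hp : p ≠ 0) {n : ℕ} (hn : 1 ≤ n) : phi p n 0 = 0 := by
  have : (0 : ℝ) < n := by exact_mod_cast hn
  simp [phi, this, Real.zero_rpow hp]

lemma phiDerivPos_of_nonpos {p : ℝ} (hp : p ≠ 1) (n : ℕ) {x : ℝ} (hx : x ≤ 0) :
    phiDerivPos p n x = 0 := by
  have h : max 0 (min x n) = 0 := max_eq_left ((min_le_left _ _).trans hx)
  rw [phiDerivPos, h, max_eq_left hx, Real.zero_rpow (sub_ne_zero.2 hp)]
  ring

lemma phiDerivPos_of_mem_Icc (p : ℝ) {n : ℕ} {x : ℝ} (h0 : 0 ≤ x) (hx : x ≤ n) :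
    phiDerivPos p n x = p * x ^ (p - 1) := by
  rw [phiDerivPos, min_eq_left hx, max_eq_right h0]
  ring

lemma phiDerivPos_of_le (p : ℝ) {n : ℕ} {x : ℝ} (hx : n ≤ x) :
    phiDerivPos p n x
      = p * (n : ℝ) ^ (p - 1) + p * (p - 1) * (n : ℝ) ^ (p - 2) * (x - n) := by
  have hn : (0 : ℝ) ≤ n := n.cast_nonneg
  rw [phiDerivPos, min_eq_right hx, max_eq_right hn, max_eq_right (hn.trans hx)]

lemma abs_rpow_sub_rpow_le {q : ℝ} (hq : 1 ≤ q) {N x y : ℝ}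
    (hx : x ∈ Set.Icc 0 N) (hy : y ∈ Set.Icc 0 N) :
    |x ^ q - y ^ q| ≤ q * N ^ (q - 1) * |x - y| := by
  refine (convex_Icc (0 : ℝ) N).norm_image_sub_le_of_norm_hasDerivWithin_le
    (f := fun z : ℝ => z ^ q) (f' := fun z => q * z ^ (q - 1))
    (fun z _ => (Real.hasDerivAt_rpow_const (Or.inr hq)).hasDerivWithinAt) ?_ hy hx
  intro z hz
  have h0 : 0 ≤ z ^ (q - 1) := Real.rpow_nonneg hz.1 _
  rw [Real.norm_of_nonneg (by positivity)]
  exact mul_le_mul_of_nonneg_left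
    (Real.rpow_le_rpow hz.1 hz.2 (by linarith)) (by linarith)

lemma exists_abs_phiDerivPos_sub_le {p : ℝ} (hp : 2 ≤ p) (n : ℕ) :
    ∃ C : ℝ, 0 ≤ C ∧ ∀ x y, |phiDerivPos p n x - phiDerivPos p n y| ≤ C * |x - y| := by
  have hn : (0 : ℝ) ≤ n := n.cast_nonneg
  set K : ℝ := p * (p - 1) * (n : ℝ) ^ (p - 2) with hK
  have hK0 : 0 ≤ K :=
    mul_nonneg (mul_nonneg (by linarith) (by linarith)) (Real.rpow_nonneg hn _)
  refine ⟨3 * K, by positivity, fun x y => ?_⟩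
  have hmem : ∀ z : ℝ, max 0 (min z n) ∈ Set.Icc (0 : ℝ) n := fun z =>
    ⟨le_max_left _ _, max_le hn (min_le_right _ _)⟩
  have hpow := abs_rpow_sub_rpow_le (q := p - 1) (by linarith) (hmem x) (hmem y)
  have hmin : |min x (n : ℝ) - min y n| ≤ |x - y| := by
    simpa using abs_min_sub_min_le_max x (n : ℝ) y n
  have hclamp : |max 0 (min x (n : ℝ)) - max 0 (min y n)| ≤ |x - y| := by
    have := abs_max_sub_max_le_max 0 (min x (n : ℝ)) 0 (min y n)
    simp only [sub_self, abs_zero, abs_nonneg, sup_of_le_right] at this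
    exact this.trans hmin
  have hmax : |max 0 x - max 0 y| ≤ |x - y| := by
    simpa using abs_max_sub_max_le_max 0 x 0 y
  rw [show p - 1 - 1 = p - 2 by ring] at hpow
  simp only [phiDerivPos, ← hK]
  set a := max 0 (min x (n : ℝ))
  set b := max 0 (min y (n : ℝ))
  have h1 : |p * (a ^ (p - 1) - b ^ (p - 1))| ≤ K * |x - y| := by
    rw [abs_mul, abs_of_nonneg (by linarith : 0 ≤ p)]
    calc p * |a ^ (p - 1) - b ^ (p - 1)|
        ≤ p * ((p - 1) * (n : ℝ) ^ (p - 2) * |a - b|) :=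
          mul_le_mul_of_nonneg_left hpow (by linarith)
      _ = K * |a - b| := by rw [hK]; ring
      _ ≤ K * |x - y| := mul_le_mul_of_nonneg_left hclamp hK0
  have h2 : |K * (max 0 x - max 0 y)| ≤ K * |x - y| := by
    rw [abs_mul, abs_of_nonneg hK0]
    exact mul_le_mul_of_nonneg_left hmax hK0
  have h3 : |K * (a - b)| ≤ K * |x - y| := by
    rw [abs_mul, abs_of_nonneg hK0]
    exact mul_le_mul_of_nonneg_left hclamp hK0
  rw [abs_le] at h1 h2 h3 ⊢
  constructor <;> linarith [h1.1, h1.2, h2.1, h2.2, h3.1, h3.2]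

lemma hasDerivAt_phi_of_nonneg {p : ℝ} (hp : 2 ≤ p) {n : ℕ} (hn : 1 ≤ n) {r : ℝ} (hr : 0 ≤ r) :
    HasDerivAt (phi p n) (phiDerivPos p n r) r := by
  have hn0 : (0 : ℝ) < n := by exact_mod_cast hn
  have hleft : r ≤ n → HasDerivAt (fun x : ℝ => |x| ^ p) (phiDerivPos p n r) r := by
    intro h
    rw [phiDerivPos_of_mem_Icc p hr h]
    convert hasDerivAt_abs_rpow r (by linarith : 1 < p) using 1
    rcases hr.eq_or_lt with rfl | h0
    · simp [Real.zero_rpow (by linarith : p - 1 ≠ 0)]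
    · rw [abs_of_pos h0, mul_assoc, ← Real.rpow_add_one h0.ne']
      ring_nf
  have hright : n ≤ r → HasDerivAt (fun x : ℝ => (n : ℝ) ^ (p - 2) * (p * (p - 1) / 2) *
      (x - n) ^ 2 + p * (n : ℝ) ^ (p - 1) * (x - n) + (n : ℝ) ^ p) (phiDerivPos p n r) r := by
    intro h
    rw [phiDerivPos_of_le p h]
    have hd := (hasDerivAt_id r).sub_const (n : ℝ)
    refine ((((hd.pow 2).const_mul ((n : ℝ) ^ (p - 2) * (p * (p - 1) / 2))).add
      (hd.const_mul (p * (n : ℝ) ^ (p - 1)))).add_const ((n : ℝ) ^ p)).congr_deriv ?_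
    simp only [id]
    push_cast
    ring
  have heq_right : ∀ x : ℝ, n ≤ x → phi p n x = (n : ℝ) ^ (p - 2) * (p * (p - 1) / 2) *
      (x - n) ^ 2 + p * (n : ℝ) ^ (p - 1) * (x - n) + (n : ℝ) ^ p := by
    intro x hx
    rw [phi, abs_of_pos (hn0.trans_le hx), if_neg hx.not_gt]
  rcases lt_trichotomy r n with h | rfl | h
  · refine (hleft h.le).congr_of_eventuallyEq ?_
    have : ∀ᶠ x : ℝ in nhds r, |x| < (n : ℝ) :=
      continuous_abs.continuousAt.eventually_lt_const (by rwa [abs_of_nonneg hr])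
    filter_upwards [this] with x hx
    simp [phi, hx]
  · rw [← hasDerivWithinAt_univ, ← Set.Iic_union_Ici (a := (n : ℝ))]
    refine HasDerivWithinAt.union ?_ ?_
    · refine (hleft le_rfl).hasDerivWithinAt.congr_of_eventuallyEq_of_mem ?_ Set.self_mem_Iic
      filter_upwards [self_mem_nhdsWithin, mem_nhdsWithin_of_mem_nhds (Ioi_mem_nhds hn0)]
        with x hx hx0
      rcases (Set.mem_Iic.1 hx).eq_or_lt with rfl | hx
      · simp [phi]
      · rw [phi, if_pos (by rwa [abs_of_pos hx0])]
    · exact (hright le_rfl).hasDerivWithinAt.congr heq_right (heq_right _ le_rfl)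
  · refine (hright h.le).congr_of_eventuallyEq ?_
    filter_upwards [Ioi_mem_nhds h] with x hx using heq_right x (le_of_lt hx)

lemma hasDerivAt_phi {p : ℝ} (hp : 2 ≤ p) {n : ℕ} (hn : 1 ≤ n) (r : ℝ) :
    HasDerivAt (phi p n) (phiDerivPos p n r - phiDerivPos p n (-r)) r := by
  have hp1 : p ≠ 1 := by linarith
  rcases le_total 0 r with h | h
  · rw [phiDerivPos_of_nonpos hp1 n (neg_nonpos.2 h), sub_zero]
    exact hasDerivAt_phi_of_nonneg hp hn h
  · rw [phiDerivPos_of_nonpos hp1 n h, zero_sub]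
    have := (hasDerivAt_phi_of_nonneg hp hn (neg_nonneg.2 h)).comp r (hasDerivAt_neg r)
    rw [mul_neg_one] at this
    exact this.congr_of_eventuallyEq (Filter.Eventually.of_forall fun x => (phi_neg p n x).symm)

/-- For `p ≥ 2` and `n ≥ 1` there is a constant `C = C(p, n)` such that for
every `r ∈ ℝ`: `φ_n(r) ≤ C r²`, `|φ_n'(r)| ≤ C |r|`, and `φ_n''(r) ≤ C`. -/
theorem statement8 (p : ℝ) (hp : 2 ≤ p) (n : ℕ) (hn : 1 ≤ n) :
    ∃ C : ℝ, ∀ r : ℝ,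
      phi p n r ≤ C * r ^ 2 ∧ |deriv (phi p n) r| ≤ C * |r| ∧ deriv (deriv (phi p n)) r ≤ C := by
  obtain ⟨C, hC, hlip⟩ := exists_abs_phiDerivPos_sub_le hp n
  have hderiv : deriv (phi p n) = fun r => phiDerivPos p n r - phiDerivPos p n (-r) :=
    funext fun r => (hasDerivAt_phi hp hn r).deriv
  have hlip' : ∀ x y, |deriv (phi p n) x - deriv (phi p n) y| ≤ 2 * C * |x - y| := by
    intro x y
    have h1 := hlip x y
    have h2 := hlip (-x) (-y)
    rw [show -x - -y = -(x - y) by ring, abs_neg] at h2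
    rw [hderiv]
    rw [abs_le] at h1 h2 ⊢
    constructor <;> linarith [h1.1, h1.2, h2.1, h2.2]
  have hbound : ∀ r, |deriv (phi p n) r| ≤ 2 * C * |r| := by
    intro r
    have h0 : deriv (phi p n) 0 = 0 := by simp [hderiv]
    simpa [h0] using hlip' r 0
  refine ⟨2 * C, fun r => ⟨?_, hbound r, ?_⟩⟩
  · have h := (convex_Icc (-|r|) |r|).norm_image_sub_le_of_norm_deriv_le
      (f := phi p n) (C := 2 * C * |r|)
      (fun x _ => (hasDerivAt_phi hp hn x).differentiableAt)
      (fun x hx => (hbound x).trans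
        (mul_le_mul_of_nonneg_left (abs_le.2 hx) (by positivity)))
      (x := 0) (y := r) (Set.mem_Icc.2 ⟨by simp, abs_nonneg r⟩) (Set.mem_Icc.2 (abs_le.1 le_rfl))
    rw [phi_zero (by linarith) hn, sub_zero, sub_zero, Real.norm_eq_abs, Real.norm_eq_abs,
      mul_assoc, abs_mul_abs_self, ← sq] at h
    exact (le_abs_self _).trans h
  · have hL : LipschitzWith (2 * C).toNNReal (deriv (phi p n)) :=
      LipschitzWith.of_dist_le_mul fun x y => by
        rw [Real.dist_eq, Real.dist_eq, Real.coe_toNNReal _ (by positivity)]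
        exact hlip' x y
    have h := norm_deriv_le_of_lipschitz (x₀ := r) hL
    rw [Real.coe_toNNReal _ (by positivity)] at h
    exact (le_abs_self _).trans h
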